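/- Suppose 𝒜 is supersolvable: there is a chain of subarrangements 𝒜_1 ⊂ ⋯ ⊂ 𝒜_r = 𝒜 such that rank(𝒜_p) = p for each p, and for any distinct H, H' ∈ 𝒜_p with H ∩ H' ≠ ∅ there exists H'' ∈ 𝒜_i with i < p and H ∩ H' ⊆ H''. Set ℬ_p = 𝒜_p ∖ 𝒜_{p−1} (with 𝒜_0 = ∅), and suppose the linear order on 𝒜 is such that every element of ℬ_{p−1} precedes every element of ℬ_p, for 1 < p ≤ r. Then a standard ordered base B = (H_{i_1}, …, H_{i_r}) is an nbc-base if and only if H_{i_p} ∈ ℬ_p for all p, and B is a βnbc-base if and only if H_{i_p} ∈ ℬ_p ∖ {min ℬ_p} for all p. -/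

import Mathlib

open Module

noncomputable section

/-- An arrangement of `n` (affine) hyperplanes inside the ambient affine subspace `amb`
of the complex vector space `W`.  The linear order on the hyperplanes is the order of the
indices in `Fin n`; an arbitrary linear order is encoded by a permutation `σ` of `Fin n`,
with `i ≺ j ↔ σ i < σ j`. -/
structure HArr (W : Type) [AddCommGroup W] [Module ℂ W] (n : ℕ) where
  amb : AffineSubspace ℂ W
  amb_ne : (amb : Set W).Nonempty
  H : Fin n → AffineSubspace ℂ W
  inj : Function.Injective H
  le_amb : ∀ i, H i ≤ amb
  nonemptyH : ∀ i, ((H i : Set W)).Nonempty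
  hyp : ∀ i, finrank ℂ (H i).direction + 1 = finrank ℂ amb.direction

namespace HArr

variable {W : Type} [AddCommGroup W] [Module ℂ W] {n : ℕ}

/-- The intersection `⋂ S` of a subset of the arrangement (the ambient space for `S = ∅`). -/
def inter (A : HArr W n) (S : Finset (Fin n)) : AffineSubspace ℂ W :=
  A.amb ⊓ S.inf A.H

/-- Codimension (inside the ambient space) of an affine subspace. -/
def cd (A : HArr W n) (X : AffineSubspace ℂ W) : ℕ :=
  finrank ℂ A.amb.direction - finrank ℂ X.direction

/-- A dependent subset of the arrangement. -/
def dep (A : HArr W n) (S : Finset (Fin n)) : Prop :=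
  A.inter S ≠ ⊥ ∧ A.cd (A.inter S) < S.card

/-- An independent subset of the arrangement. -/
def indep (A : HArr W n) (S : Finset (Fin n)) : Prop :=
  A.inter S ≠ ⊥ ∧ A.cd (A.inter S) = S.card

/-- A base: a maximal independent subset. -/
def isBase (A : HArr W n) (S : Finset (Fin n)) : Prop :=
  A.indep S ∧ ∀ T, A.indep T → S ⊆ T → S = T

open scoped Classical in
/-- The rank of a subarrangement `{H i : i ∈ C}`. -/
def rankOn (A : HArr W n) (C : Finset (Fin n)) : ℕ :=
  C.powerset.sup fun S => if A.indep S then S.card else 0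

/-- The rank `r` of the arrangement. -/
def rank (A : HArr W n) : ℕ := A.rankOn Finset.univ

/-- A circuit: an inclusion-minimal dependent set. -/
def circuit (A : HArr W n) (S : Finset (Fin n)) : Prop :=
  A.dep S ∧ ∀ T ⊂ S, ¬ A.dep T

/-- A broken circuit w.r.t. the linear order given by `σ`. -/
def brokenCircuit (A : HArr W n) (σ : Equiv.Perm (Fin n)) (S : Finset (Fin n)) : Prop :=
  ∃ i ∉ S, (∀ j ∈ S, σ i < σ j) ∧ A.circuit (insert i S)

/-- An nbc set: nonempty intersection and containing no broken circuit. -/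
def nbcSet (A : HArr W n) (σ : Equiv.Perm (Fin n)) (S : Finset (Fin n)) : Prop :=
  A.inter S ≠ ⊥ ∧ ∀ T ⊆ S, ¬ A.brokenCircuit σ T

/-- An nbc-base. -/
def nbcBase (A : HArr W n) (σ : Equiv.Perm (Fin n)) (S : Finset (Fin n)) : Prop :=
  A.nbcSet σ S ∧ A.isBase S

/-- A βnbc-base. -/
def betaNbcBase (A : HArr W n) (σ : Equiv.Perm (Fin n)) (S : Finset (Fin n)) : Prop :=
  A.nbcBase σ S ∧ ∀ i ∈ S, ∃ j, σ j < σ i ∧ A.isBase (insert j (S.erase i))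

/-- Membership in the intersection poset `L(𝒜)`. -/
def memL (A : HArr W n) (X : AffineSubspace ℂ W) : Prop :=
  X ≠ ⊥ ∧ ∃ S : Finset (Fin n), A.inter S = X

/-- A maximal element of `L(𝒜)` (in the reverse-inclusion order). -/
def maximalL (A : HArr W n) (X : AffineSubspace ℂ W) : Prop :=
  A.memL X ∧ ∀ Y, A.memL Y → Y ≤ X → Y = X

open scoped Classical in
/-- The set of indices of hyperplanes containing `X`, i.e. `𝒜_X`. -/
def sub (A : HArr W n) (X : AffineSubspace ℂ W) : Finset (Fin n) :=
  Finset.univ.filter fun i => X ≤ A.H i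

/-- `X` is dense: `𝒜_X` admits no decomposition into two nonempty parts. -/
def denseL (A : HArr W n) (X : AffineSubspace ℂ W) : Prop :=
  ¬ ∃ S T : Finset (Fin n), Disjoint S T ∧ S.Nonempty ∧ T.Nonempty ∧
      S ∪ T = A.sub X ∧ A.cd (A.inter S) + A.cd (A.inter T) = A.cd X

/-- `i` is the minimum of `S` w.r.t. the linear order given by `σ`. -/
def isMin (σ : Equiv.Perm (Fin n)) (i : Fin n) (S : Finset (Fin n)) : Prop :=
  i ∈ S ∧ ∀ j ∈ S, σ i ≤ σ j

/-- The standard ordered tuple of a finite set, w.r.t. the linear order given by `σ`: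
`tup σ S p` is the element of `S` with `(p+1)`-st smallest `σ`-value. -/
def tup (σ : Equiv.Perm (Fin n)) (S : Finset (Fin n)) (p : Fin S.card) : Fin n :=
  σ.symm (((S.image ⇑σ).orderIsoOfFin (Finset.card_image_of_injective S σ.injective) p).1)

/-- The flag `ξ(B) = (X_1 > ⋯ > X_r)` of a standard ordered base:
`flag σ S p = X_{p+1} = ⋂_{k ≥ p} H_{i_k}`. -/
def flag (A : HArr W n) (σ : Equiv.Perm (Fin n)) (S : Finset (Fin n)) (p : Fin S.card) :
    AffineSubspace ℂ W :=
  A.inter (S.filter fun i => σ (tup σ S p) ≤ σ i)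

/-- Lexicographic order on standard ordered tuples (for the canonical order). -/
def lexLt (S T : Finset (Fin n)) : Prop :=
  List.Lex (· < ·) (S.sort (· ≤ ·)) (T.sort (· ≤ ·))

/-- `λ(X) = Σ_{H_i ∈ 𝒜_X} λ_i`. -/
def lamX (A : HArr W n) (lam : Fin n → ℂ) (X : AffineSubspace ℂ W) : ℂ :=
  ∑ i ∈ A.sub X, lam i

/-- `X` is unmixed (w.r.t. the order `σ`). -/
def unmixedX (A : HArr W n) (σ : Equiv.Perm (Fin n)) (X : AffineSubspace ℂ W) : Prop :=
  (∀ S, A.nbcBase σ S → A.inter S = X → A.betaNbcBase σ S) ∨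
  (∀ S, A.nbcBase σ S → A.inter S = X → ¬ A.betaNbcBase σ S)

/-- The linear order given by `σ` is unmixed. -/
def unmixedOrd (A : HArr W n) (σ : Equiv.Perm (Fin n)) : Prop :=
  ∀ X, A.maximalL X → A.unmixedX σ X

/-- Membership in the intersection poset of the deleted arrangement `𝒜 ∖ {H_{i₀}}`. -/
def memLdel (A : HArr W n) (i₀ : Fin n) (X : AffineSubspace ℂ W) : Prop :=
  X ≠ ⊥ ∧ ∃ S : Finset (Fin n), i₀ ∉ S ∧ A.inter S = X

/-- A maximal element of the intersection poset of the deleted arrangement. -/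
def maximalLdel (A : HArr W n) (i₀ : Fin n) (X : AffineSubspace ℂ W) : Prop :=
  A.memLdel i₀ X ∧ ∀ Y, A.memLdel i₀ Y → Y ≤ X → Y = X

/-- The generator `e_i` of the exterior algebra `E`. -/
def gen (i : Fin n) : ExteriorAlgebra ℂ (Fin n → ℂ) :=
  ExteriorAlgebra.ι ℂ (Pi.single i 1)

/-- `e_S = e_{i_1} ∧ ⋯ ∧ e_{i_p}` for `S = {i_1 < ⋯ < i_p}`. -/
def eS (S : Finset (Fin n)) : ExteriorAlgebra ℂ (Fin n → ℂ) :=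
  ((S.sort (· ≤ ·)).map gen).prod

/-- `∂e_S = Σ_k (−1)^{k−1} e_{S ∖ {i_k}}`. -/
def bdry (S : Finset (Fin n)) : ExteriorAlgebra ℂ (Fin n → ℂ) :=
  ∑ i ∈ S, ((-1 : ℂ) ^ (S.filter fun j => j < i).card) • eS (S.erase i)

/-- The defining relations of the Orlik–Solomon algebra. -/
inductive OSRel (A : HArr W n) :
    ExteriorAlgebra ℂ (Fin n → ℂ) → ExteriorAlgebra ℂ (Fin n → ℂ) → Prop
  | isBot : ∀ S : Finset (Fin n), A.inter S = ⊥ → OSRel A (eS S) 0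
  | isDep : ∀ S : Finset (Fin n), A.dep S → OSRel A (bdry S) 0

/-- The Orlik–Solomon algebra `A(𝒜)`: the exterior algebra modulo the ideal generated by
the `e_S` with empty intersection and the `∂e_S` with `S` dependent. -/
abbrev OS (A : HArr W n) := RingQuot (OSRel A)

/-- The quotient map `E → A(𝒜)`. -/
def osMk (A : HArr W n) : ExteriorAlgebra ℂ (Fin n → ℂ) →ₐ[ℂ] OS A :=
  RingQuot.mkAlgHom ℂ (OSRel A)

/-- `ω_i`, the image of `e_i` in the Orlik–Solomon algebra. -/
def om (A : HArr W n) (i : Fin n) : OS A := osMk A (gen i)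

/-- `ω_B`, the image of `e_B` in the Orlik–Solomon algebra. -/
def omB (A : HArr W n) (S : Finset (Fin n)) : OS A := osMk A (eS S)

/-- The degree `p` part `A^p` of the Orlik–Solomon algebra. -/
def deg (A : HArr W n) (p : ℕ) : Submodule ℂ (OS A) :=
  Submodule.span ℂ {x | ∃ S : Finset (Fin n), S.card = p ∧ x = omB A S}

/-- `ω_λ = Σ_i λ_i ω_i`. -/
def omLam (A : HArr W n) (lam : Fin n → ℂ) : OS A := ∑ i, lam i • om A i

/-- `ω_λ(X) = Σ_{H_i ∈ 𝒜_X} λ_i ω_i`. -/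
def omLamX (A : HArr W n) (lam : Fin n → ℂ) (X : AffineSubspace ℂ W) : OS A :=
  ∑ i ∈ A.sub X, lam i • om A i

/-- The form `Ξ(B) = ω_λ(X_1) ⋯ ω_λ(X_r)` attached to a standard ordered base. -/
def Xi (A : HArr W n) (σ : Equiv.Perm (Fin n)) (lam : Fin n → ℂ) (S : Finset (Fin n)) :
    OS A :=
  ((List.finRange S.card).map fun p => A.omLamX lam (A.flag σ S p)).prod

/-- The submodule `ω_λ ∧ A^p` of the Orlik-Solomon algebra. -/
def Ideg (A : HArr W n) (lam : Fin n → ℂ) (p : ℕ) : Submodule ℂ (OS A) :=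
  (A.deg p).map (LinearMap.mulLeft ℂ (A.omLam lam))

end HArr

namespace HArr

variable {W : Type} [AddCommGroup W] [Module ℂ W] {n : ℕ}

/-- The common direction `⋂_{i ∈ S} dir (H i)` of a subset of the arrangement. -/
def dirInter (A : HArr W n) (S : Finset (Fin n)) : Submodule ℂ W :=
  A.amb.direction ⊓ S.inf fun i => (A.H i).direction

/-- Linear independence of the defining forms of the hyperplanes indexed by `S`. -/
def linIndep (A : HArr W n) (S : Finset (Fin n)) : Prop :=
  finrank ℂ (A.dirInter S) + S.card = finrank ℂ A.amb.direction

theorem direction_le_amb (A : HArr W n) (i : Fin n) : (A.H i).direction ≤ A.amb.direction :=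
  AffineSubspace.direction_le (A.le_amb i)

theorem dirInter_empty (A : HArr W n) : A.dirInter ∅ = A.amb.direction := by
  simp [dirInter]

theorem dirInter_insert (A : HArr W n) (i : Fin n) (S : Finset (Fin n)) :
    A.dirInter (insert i S) = A.dirInter S ⊓ (A.H i).direction := by
  simp only [dirInter, Finset.inf_insert]
  ac_rfl

theorem dirInter_singleton (A : HArr W n) (i : Fin n) :
    A.dirInter {i} = (A.H i).direction := by
  simpa [dirInter] using A.direction_le_amb i

theorem dirInter_anti (A : HArr W n) {S T : Finset (Fin n)} (h : S ⊆ T) :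
    A.dirInter T ≤ A.dirInter S :=
  inf_le_inf_left _ (Finset.inf_mono h)

theorem dirInter_le_amb (A : HArr W n) (S : Finset (Fin n)) :
    A.dirInter S ≤ A.amb.direction := inf_le_left

theorem dirInter_le (A : HArr W n) {S : Finset (Fin n)} {i : Fin n} (h : i ∈ S) :
    A.dirInter S ≤ (A.H i).direction :=
  inf_le_right.trans (Finset.inf_le h)

theorem le_dirInter (A : HArr W n) {S : Finset (Fin n)} {X : Submodule ℂ W}
    (h0 : X ≤ A.amb.direction) (h : ∀ i ∈ S, X ≤ (A.H i).direction) : X ≤ A.dirInter S :=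
  le_inf h0 (Finset.le_inf h)

theorem inter_insert (A : HArr W n) (i : Fin n) (S : Finset (Fin n)) :
    A.inter (insert i S) = A.inter S ⊓ A.H i := by
  simp only [inter, Finset.inf_insert]
  ac_rfl

theorem inter_anti (A : HArr W n) {S T : Finset (Fin n)} (h : S ⊆ T) :
    A.inter T ≤ A.inter S :=
  inf_le_inf_left _ (Finset.inf_mono h)

theorem inter_ne_bot_mono (A : HArr W n) {S T : Finset (Fin n)} (h : S ⊆ T)
    (hT : A.inter T ≠ ⊥) : A.inter S ≠ ⊥ :=
  ne_bot_of_le_ne_bot hT (A.inter_anti h)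

theorem inter_le (A : HArr W n) {S : Finset (Fin n)} {i : Fin n} (h : i ∈ S) :
    A.inter S ≤ A.H i :=
  inf_le_right.trans (Finset.inf_le h)

theorem direction_inter (A : HArr W n) {S : Finset (Fin n)} (h : A.inter S ≠ ⊥) :
    (A.inter S).direction = A.dirInter S := by
  induction S using Finset.induction_on with
  | empty => simp [inter, dirInter]
  | insert i S _ ih =>
    obtain ⟨x, hx⟩ := (AffineSubspace.nonempty_iff_ne_bot _).2 h
    rw [inter_insert] at hx
    rw [inter_insert, dirInter_insert, AffineSubspace.direction_inf_of_mem hx.1 hx.2,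
      ih (A.inter_ne_bot_mono (Finset.subset_insert i S) h)]

theorem linIndep_empty (A : HArr W n) : A.linIndep ∅ := by
  rw [linIndep, dirInter_empty, Finset.card_empty, add_zero]

theorem linIndep_singleton (A : HArr W n) (i : Fin n) : A.linIndep {i} := by
  rw [linIndep, dirInter_singleton, Finset.card_singleton, A.hyp]

/-- A level function of a supersolvable arrangement whose linear order is compatible with
the chain: `lv i = p` means that `H i` belongs to the `p`-th block (blocks being counted
from `0`). -/
structure IsLevel (A : HArr W n) (lv : Fin n → ℕ) : Prop where
  lt_rank : ∀ i, lv i < A.rank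
  rankOn_lt : ∀ p ≤ A.rank, A.rankOn (Finset.univ.filter fun i => lv i < p) = p
  modular : ∀ i j, i ≠ j → lv i = lv j → A.H i ⊓ A.H j ≠ ⊥ →
    ∃ k, lv k < lv j ∧ A.H i ⊓ A.H j ≤ A.H k
  lt_of_lt : ∀ i j, lv i < lv j → i < j

theorem IsLevel.le_of_le {A : HArr W n} {lv : Fin n → ℕ} (h : A.IsLevel lv) {i j : Fin n} (hij : i ≤ j) : lv i ≤ lv j :=
  not_lt.1 fun hlt => hij.not_gt (h.lt_of_lt j i hlt)

section FiniteDimensional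

variable [FiniteDimensional ℂ W]

theorem finrank_inf_direction (A : HArr W n) {X : Submodule ℂ W} {i : Fin n}
    (hX : X ≤ A.amb.direction) (h : ¬ X ≤ (A.H i).direction) :
    finrank ℂ (X ⊓ (A.H i).direction : Submodule ℂ W) + 1 = finrank ℂ X := by
  have h1 := Submodule.finrank_sup_add_finrank_inf_eq X (A.H i).direction
  have h2 : finrank ℂ (X ⊔ (A.H i).direction : Submodule ℂ W) ≤ finrank ℂ A.amb.direction :=
    Submodule.finrank_mono (sup_le hX (A.direction_le_amb i))
  have h3 : finrank ℂ (A.H i).direction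
      < finrank ℂ (X ⊔ (A.H i).direction : Submodule ℂ W) :=
    Submodule.finrank_lt_finrank_of_lt (right_lt_sup.2 h)
  have := A.hyp i
  omega

theorem sup_direction_eq_amb (A : HArr W n) {X : Submodule ℂ W} {i : Fin n}
    (hX : X ≤ A.amb.direction) (h : ¬ X ≤ (A.H i).direction) :
    X ⊔ (A.H i).direction = A.amb.direction := by
  apply Submodule.eq_of_le_of_finrank_le (sup_le hX (A.direction_le_amb i))
  have h3 : finrank ℂ (A.H i).direction
      < finrank ℂ (X ⊔ (A.H i).direction : Submodule ℂ W) :=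
    Submodule.finrank_lt_finrank_of_lt (right_lt_sup.2 h)
  have := A.hyp i
  omega

theorem finrank_dirInter_insert_of_not_le (A : HArr W n) {S : Finset (Fin n)} {i : Fin n}
    (h : ¬ A.dirInter S ≤ (A.H i).direction) :
    finrank ℂ (A.dirInter (insert i S)) + 1 = finrank ℂ (A.dirInter S) := by
  rw [dirInter_insert]
  exact A.finrank_inf_direction (A.dirInter_le_amb S) h

theorem finrank_dirInter_le_insert (A : HArr W n) (S : Finset (Fin n)) (i : Fin n) :
    finrank ℂ (A.dirInter S) ≤ finrank ℂ (A.dirInter (insert i S)) + 1 := by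
  by_cases h : A.dirInter S ≤ (A.H i).direction
  · rw [dirInter_insert, inf_eq_left.2 h]
    omega
  · exact (A.finrank_dirInter_insert_of_not_le h).ge

theorem finrank_dirInter_le_union (A : HArr W n) (S T : Finset (Fin n)) :
    finrank ℂ (A.dirInter S) ≤ finrank ℂ (A.dirInter (T ∪ S)) + T.card := by
  induction T using Finset.induction_on with
  | empty => rw [Finset.empty_union]; exact Nat.le_add_right _ _
  | insert i T hi ih =>
    rw [Finset.insert_union, Finset.card_insert_of_notMem hi]
    have := A.finrank_dirInter_le_insert (T ∪ S) i
    omega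

theorem le_finrank_dirInter_add_card (A : HArr W n) (S : Finset (Fin n)) :
    finrank ℂ A.amb.direction ≤ finrank ℂ (A.dirInter S) + S.card := by
  have := A.finrank_dirInter_le_union ∅ S
  rwa [Finset.union_empty, dirInter_empty] at this

theorem finrank_dirInter_le_amb (A : HArr W n) (S : Finset (Fin n)) :
    finrank ℂ (A.dirInter S) ≤ finrank ℂ A.amb.direction :=
  Submodule.finrank_mono (A.dirInter_le_amb S)

theorem linIndep.mono {A : HArr W n} {S T : Finset (Fin n)} (hT : A.linIndep T) (h : S ⊆ T) :
    A.linIndep S := by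
  have h1 := A.finrank_dirInter_le_union S (T \ S)
  rw [Finset.sdiff_union_of_subset h] at h1
  have h2 := A.le_finrank_dirInter_add_card S
  have h3 := Finset.card_sdiff_add_card_eq_card h
  unfold linIndep at *
  omega

theorem linIndep.insert {A : HArr W n} {S : Finset (Fin n)} {i : Fin n} (hS : A.linIndep S)
    (h : ¬ A.dirInter S ≤ (A.H i).direction) : A.linIndep (insert i S) := by
  have hi : i ∉ S := fun hi => h (A.dirInter_le hi)
  have := A.finrank_dirInter_insert_of_not_le h
  unfold linIndep at *
  rw [Finset.card_insert_of_notMem hi]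
  omega

theorem linIndep.not_le {A : HArr W n} {S : Finset (Fin n)} {i : Fin n}
    (hS : A.linIndep (Insert.insert i S)) (hi : i ∉ S) :
    ¬ A.dirInter S ≤ (A.H i).direction := by
  intro h
  have h1 := A.le_finrank_dirInter_add_card S
  unfold linIndep at hS
  rw [Finset.card_insert_of_notMem hi, dirInter_insert, inf_eq_left.2 h] at hS
  omega

theorem inf_ne_bot_of_not_le (A : HArr W n) {X : AffineSubspace ℂ W} {i : Fin n}
    (hX : X ≠ ⊥) (hXA : X ≤ A.amb) (h : ¬ X.direction ≤ (A.H i).direction) :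
    X ⊓ A.H i ≠ ⊥ := by
  obtain ⟨x, hx⟩ := (AffineSubspace.nonempty_iff_ne_bot _).2 hX
  obtain ⟨y, hy⟩ := A.nonemptyH i
  have hd := A.sup_direction_eq_amb (AffineSubspace.direction_le hXA) h
  have hxy : y -ᵥ x ∈ X.direction ⊔ (A.H i).direction := by
    rw [hd]
    exact AffineSubspace.vsub_mem_direction (A.le_amb i hy) (hXA hx)
  obtain ⟨u, hu, v, hv, huv⟩ := Submodule.mem_sup.1 hxy
  rw [← AffineSubspace.nonempty_iff_ne_bot]
  refine ⟨u +ᵥ x, AffineSubspace.vadd_mem_of_mem_direction hu hx, ?_⟩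
  have : u +ᵥ x = -v +ᵥ y := by
    simp only [vsub_eq_sub, vadd_eq_add] at huv ⊢
    rw [eq_sub_iff_add_eq] at huv
    rw [← huv]
    abel
  rw [this]
  exact AffineSubspace.vadd_mem_of_mem_direction (neg_mem hv) hy

theorem linIndep.inter_ne_bot {A : HArr W n} {S : Finset (Fin n)} (hS : A.linIndep S) :
    A.inter S ≠ ⊥ := by
  induction S using Finset.induction_on with
  | empty =>
    rw [← AffineSubspace.nonempty_iff_ne_bot]
    simpa [inter] using A.amb_ne
  | insert i S hi ih =>
    have ih := ih (hS.mono (Finset.subset_insert i S))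
    rw [inter_insert]
    refine A.inf_ne_bot_of_not_le ih inf_le_left ?_
    rw [A.direction_inter ih]
    exact hS.not_le hi

theorem indep_iff_linIndep (A : HArr W n) (S : Finset (Fin n)) : A.indep S ↔ A.linIndep S := by
  have key : A.inter S ≠ ⊥ → (A.cd (A.inter S) = S.card ↔ A.linIndep S) := by
    intro h
    have := A.finrank_dirInter_le_amb S
    unfold cd linIndep
    rw [A.direction_inter h]
    omega
  exact ⟨fun h => (key h.1).1 h.2, fun h => ⟨h.inter_ne_bot, (key h.inter_ne_bot).2 h⟩⟩

theorem dep_iff_not_linIndep (A : HArr W n) {S : Finset (Fin n)} (h : A.inter S ≠ ⊥) :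
    A.dep S ↔ ¬ A.linIndep S := by
  have := A.finrank_dirInter_le_amb S
  have := A.le_finrank_dirInter_add_card S
  unfold dep cd linIndep
  rw [A.direction_inter h, and_iff_right h]
  omega

open scoped Classical in
theorem linIndep.card_le_rankOn {A : HArr W n} {S C : Finset (Fin n)} (hS : A.linIndep S)
    (h : S ⊆ C) : S.card ≤ A.rankOn C := by
  have := Finset.le_sup (f := fun S => if A.indep S then S.card else 0)
    (Finset.mem_powerset.2 h)
  simpa [rankOn, (A.indep_iff_linIndep S).2 hS] using this

open scoped Classical in
theorem exists_linIndep_card_eq_rankOn (A : HArr W n) (C : Finset (Fin n)) :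
    ∃ S ⊆ C, A.linIndep S ∧ S.card = A.rankOn C := by
  obtain ⟨S, hS, h⟩ := Finset.exists_mem_eq_sup C.powerset ⟨∅, by simp⟩
    (fun S => if A.indep S then S.card else 0)
  by_cases hi : A.indep S
  · exact ⟨S, Finset.mem_powerset.1 hS, (A.indep_iff_linIndep S).1 hi,
      by simpa [rankOn, hi] using h.symm⟩
  · exact ⟨∅, by simp, A.linIndep_empty, by simpa [rankOn, hi] using h.symm⟩

/-- A linearly independent subset of `C` which cannot be enlarged inside `C` has the same
common direction as `C`. -/
theorem linIndep.dirInter_eq {A : HArr W n} {S C : Finset (Fin n)} (hS : A.linIndep S)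
    (h : S ⊆ C) (hmax : ∀ i ∈ C, A.linIndep (Insert.insert i S) → i ∈ S) :
    A.dirInter S = A.dirInter C := by
  refine le_antisymm (A.le_dirInter (A.dirInter_le_amb S) fun i hi => ?_) (A.dirInter_anti h)
  by_contra hn
  exact hn (A.dirInter_le (hmax i hi (hS.insert hn)))

theorem finrank_dirInter_add_rankOn (A : HArr W n) (C : Finset (Fin n)) :
    finrank ℂ (A.dirInter C) + A.rankOn C = finrank ℂ A.amb.direction := by
  obtain ⟨S, hSC, hS, hcard⟩ := A.exists_linIndep_card_eq_rankOn C
  rw [← hS.dirInter_eq hSC, ← hcard]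
  · exact hS
  · intro i hi h
    by_contra hiS
    have := h.card_le_rankOn (Finset.insert_subset hi hSC)
    rw [Finset.card_insert_of_notMem hiS] at this
    omega

theorem isBase_iff (A : HArr W n) (S : Finset (Fin n)) :
    A.isBase S ↔ A.linIndep S ∧ S.card = A.rank := by
  unfold isBase
  simp only [indep_iff_linIndep]
  constructor
  · rintro ⟨h, hmax⟩
    refine ⟨h, ?_⟩
    have h1 := A.finrank_dirInter_add_rankOn Finset.univ
    have h2 : A.dirInter S = A.dirInter Finset.univ :=
      h.dirInter_eq (Finset.subset_univ S) fun i _ hi => by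
        rw [hmax _ hi (Finset.subset_insert i S)]
        exact Finset.mem_insert_self i S
    unfold linIndep at h
    rw [h2] at h
    unfold rank
    omega
  · rintro ⟨h, hc⟩
    refine ⟨h, fun T hT hST => Finset.eq_of_subset_of_card_le hST ?_⟩
    rw [hc]
    exact hT.card_le_rankOn (Finset.subset_univ T)

theorem eq_of_direction_le (A : HArr W n) {i j : Fin n} (h : A.H i ⊓ A.H j ≠ ⊥)
    (hd : (A.H i).direction ≤ (A.H j).direction) : i = j := by
  have hi := A.hyp i
  have hj := A.hyp j
  have hd' := Submodule.eq_of_le_of_finrank_le hd (by omega)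
  exact A.inj (AffineSubspace.ext_of_direction_eq hd'
    ((AffineSubspace.nonempty_iff_ne_bot _).2 h))

theorem linIndep_of_card_le_two (A : HArr W n) {S : Finset (Fin n)} (hS : S.card ≤ 2)
    (h : A.inter S ≠ ⊥) : A.linIndep S := by
  obtain h0 | h1 | h2 : S.card = 0 ∨ S.card = 1 ∨ S.card = 2 := by omega
  · rw [Finset.card_eq_zero.1 h0]
    exact A.linIndep_empty
  · obtain ⟨i, rfl⟩ := Finset.card_eq_one.1 h1
    exact A.linIndep_singleton i
  · obtain ⟨i, j, hij, rfl⟩ := Finset.card_eq_two.1 h2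
    refine (A.linIndep_singleton j).insert fun hd => hij ?_
    rw [dirInter_singleton] at hd
    refine (A.eq_of_direction_le (ne_bot_of_le_ne_bot h ?_) hd).symm
    exact le_inf (A.inter_le (by simp)) (A.inter_le (by simp))

/-- If `C ⊆ C'` has smaller rank, and any two intersecting hyperplanes of `C'` intersect
inside a hyperplane of `C`, then no hyperplane of `C' ∖ C` contains the common direction
of `C`. -/
theorem not_dirInter_le_of_modular (A : HArr W n) {C C' : Finset (Fin n)}
    (hrank : A.rankOn C < A.rankOn C')
    (hmod : ∀ i ∈ C', ∀ j ∈ C', i ≠ j → A.H i ⊓ A.H j ≠ ⊥ → ∃ k ∈ C, A.H i ⊓ A.H j ≤ A.H k)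
    {i : Fin n} (hi : i ∈ C') (hiC : i ∉ C) : ¬ A.dirInter C ≤ (A.H i).direction := by
  intro hle
  have h1 := A.finrank_dirInter_add_rankOn C
  have h2 := A.finrank_dirInter_add_rankOn C'
  obtain ⟨g, hg, hgC⟩ : ∃ g ∈ C', ¬ A.dirInter C ≤ (A.H g).direction := by
    by_contra! hcon
    have := Submodule.finrank_mono (A.le_dirInter (A.dirInter_le_amb C) hcon)
    omega
  have hig : ¬ (A.H i).direction ≤ (A.H g).direction := fun h => hgC (hle.trans h)
  have hne : i ≠ g := fun h => hig (h ▸ le_rfl)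
  have hbot : A.H i ⊓ A.H g ≠ ⊥ :=
    A.inf_ne_bot_of_not_le ((AffineSubspace.nonempty_iff_ne_bot _).1 (A.nonemptyH i))
      (A.le_amb i) hig
  obtain ⟨k, hk, hkle⟩ := hmod i hi g hg hne hbot
  have hdir : (A.H i).direction ⊓ (A.H g).direction ≤ (A.H k).direction := by
    obtain ⟨x, hx⟩ := (AffineSubspace.nonempty_iff_ne_bot _).2 hbot
    rw [← AffineSubspace.direction_inf_of_mem hx.1 hx.2]
    exact AffineSubspace.direction_le hkle
  have hlt : (A.H i).direction ⊓ (A.H g).direction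
      < (A.H i).direction ⊓ (A.H k).direction := by
    refine lt_of_le_not_ge (le_inf inf_le_left hdir) fun hge => hgC ?_
    exact (le_inf hle (A.dirInter_le hk)).trans (hge.trans inf_le_right)
  have h3 := Submodule.finrank_lt_finrank_of_lt hlt
  have h4 := A.finrank_inf_direction (A.direction_le_amb i) hig
  have hik : (A.H i).direction ≤ (A.H k).direction := by
    rw [← inf_eq_left]
    exact Submodule.eq_of_le_of_finrank_le inf_le_left (by omega)
  have : i = k := A.eq_of_direction_le
    (ne_bot_of_le_ne_bot hbot (le_inf inf_le_left hkle)) hik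
  exact hiC (this ▸ hk)

namespace IsLevel

variable {A : HArr W n} {lv : Fin n → ℕ}

theorem not_dirInter_le (h : A.IsLevel lv) {S : Finset (Fin n)} {i : Fin n}
    (hS : ∀ j ∈ S, lv j < lv i) : ¬ A.dirInter S ≤ (A.H i).direction := by
  intro hle
  have hr := h.lt_rank i
  refine A.not_dirInter_le_of_modular (C := Finset.univ.filter fun j => lv j < lv i)
    (C' := Finset.univ.filter fun j => lv j < lv i + 1) (i := i) ?_ ?_ (by simp) (by simp)
    ((A.dirInter_anti fun j hj => by simpa using hS j hj).trans hle)
  · rw [h.rankOn_lt _ hr.le, h.rankOn_lt _ hr]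
    omega
  · intro a ha b hb hab hbot
    simp only [Finset.mem_filter, Finset.mem_univ, true_and] at ha hb ⊢
    by_cases ha' : lv a < lv i
    · exact ⟨a, ha', inf_le_left⟩
    by_cases hb' : lv b < lv i
    · exact ⟨b, hb', inf_le_right⟩
    obtain ⟨k, hk, hle⟩ := h.modular a b hab (by omega) hbot
    exact ⟨k, by omega, hle⟩

theorem linIndep_of_injOn (h : A.IsLevel lv) {S : Finset (Fin n)}
    (hS : Set.InjOn lv (S : Set (Fin n))) : A.linIndep S := by
  induction S using Finset.induction_on_max_value lv with
  | empty => exact A.linIndep_empty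
  | insert a s ha hmax ih =>
    have hsub : (s : Set (Fin n)) ⊆ (insert a s : Finset (Fin n)) := by simp
    refine (ih (hS.mono hsub)).insert (h.not_dirInter_le fun j hj => ?_)
    refine lt_of_le_of_ne (hmax j hj) fun he => ha ?_
    rwa [← hS (Finset.mem_insert_of_mem hj) (Finset.mem_insert_self a s) he]

theorem card_le (h : A.IsLevel lv) {S : Finset (Fin n)} (hS : A.linIndep S) {p : ℕ}
    (hp : p ≤ A.rank) (hlt : ∀ i ∈ S, lv i < p) : S.card ≤ p := by
  rw [← h.rankOn_lt p hp]
  exact hS.card_le_rankOn fun i hi => by simpa using hlt i hi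

theorem nbcBase_iff (h : A.IsLevel lv) {S : Finset (Fin n)} (hS : A.isBase S) :
    A.nbcBase 1 S ↔ Set.InjOn lv (S : Set (Fin n)) := by
  have hbot := hS.1.1
  constructor
  · rintro ⟨⟨-, hbc⟩, -⟩ i hi j hj hlv
    by_contra hij
    have hijbot : A.H i ⊓ A.H j ≠ ⊥ :=
      ne_bot_of_le_ne_bot hbot (le_inf (A.inter_le hi) (A.inter_le hj))
    obtain ⟨k, hk, hle⟩ := h.modular i j hij hlv hijbot
    have hki := h.lt_of_lt k i (by omega)
    have hkj := h.lt_of_lt k j hk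
    have hkS : k ∉ ({i, j} : Finset (Fin n)) := by
      simp [hki.ne, hkj.ne]
    have hbot3 : A.inter {k, i, j} ≠ ⊥ := by
      refine ne_bot_of_le_ne_bot hijbot (le_inf (inf_le_left.trans (A.le_amb i)) ?_)
      simp [hle]
    refine hbc {i, j} (by simp [Finset.insert_subset_iff, Finset.mem_coe.1 hi,
      Finset.mem_coe.1 hj]) ⟨k, hkS, by simp [hki, hkj], ?_, fun T hT hdep => ?_⟩
    · refine (A.dep_iff_not_linIndep hbot3).2 fun hl => hl.not_le hkS ?_
      have hb2 := A.inter_ne_bot_mono (Finset.subset_insert k {i, j}) hbot3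
      rw [← A.direction_inter hb2]
      refine AffineSubspace.direction_le (le_trans ?_ hle)
      exact le_inf (A.inter_le (by simp)) (A.inter_le (by simp))
    · refine (A.dep_iff_not_linIndep hdep.1).1 hdep (A.linIndep_of_card_le_two ?_ hdep.1)
      have h1 := Finset.card_lt_card hT
      have h2 := Finset.card_le_three (a := k) (b := i) (c := j)
      omega
  · intro hinj
    refine ⟨⟨hbot, ?_⟩, hS⟩
    rintro T hTS ⟨i, hiT, hlt, hdep, hmin⟩
    refine (A.dep_iff_not_linIndep hdep.1).1 hdep ?_
    by_cases hT : T.card ≤ 1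
    · exact A.linIndep_of_card_le_two ((Finset.card_insert_le i T).trans (by omega)) hdep.1
    obtain ⟨m, hm, hmax⟩ := Finset.exists_max_image T lv (Finset.card_pos.1 (by omega))
    have hlvm : ∀ t ∈ T.erase m, lv t < lv m := fun t ht =>
      lt_of_le_of_ne (hmax t (Finset.mem_of_mem_erase ht)) fun he =>
        Finset.ne_of_mem_erase ht
          (hinj (hTS (Finset.mem_of_mem_erase ht)) (hTS hm) he)
    have him : i ≠ m := fun he => hiT (he ▸ hm)
    obtain ⟨t, ht⟩ : (T.erase m).Nonempty :=
      Finset.card_pos.1 (by rw [Finset.card_erase_of_mem hm]; omega)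
    have hlvi : lv i < lv m :=
      (h.le_of_le (hlt t (Finset.mem_of_mem_erase ht)).le).trans_lt (hlvm t ht)
    have hins : insert m (insert i (T.erase m)) = insert i T := by
      rw [Finset.insert_comm, Finset.insert_erase hm]
    have hmU : m ∉ insert i (T.erase m) := by simp [him.symm]
    have hU : insert i (T.erase m) ⊂ insert i T := by
      rw [← hins]
      exact Finset.ssubset_insert hmU
    have hUl : A.linIndep (insert i (T.erase m)) := by
      by_contra hn
      exact hmin _ hU
        ((A.dep_iff_not_linIndep (A.inter_ne_bot_mono hU.subset hdep.1)).2 hn)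
    rw [← hins]
    refine hUl.insert (h.not_dirInter_le fun j hj => ?_)
    rcases Finset.mem_insert.1 hj with rfl | hj
    · exact hlvi
    · exact hlvm j hj

theorem image_eq_range (h : A.IsLevel lv) {S : Finset (Fin n)} (hS : A.isBase S)
    (hinj : Set.InjOn lv (S : Set (Fin n))) : S.image lv = Finset.range A.rank := by
  refine Finset.eq_of_subset_of_card_le (fun p hp => ?_) ?_
  · obtain ⟨i, -, rfl⟩ := Finset.mem_image.1 hp
    exact Finset.mem_range.2 (h.lt_rank i)
  · rw [Finset.card_image_of_injOn hinj, ((A.isBase_iff S).1 hS).2, Finset.card_range]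

theorem betaNbcBase_iff (h : A.IsLevel lv) {S : Finset (Fin n)} (hS : A.isBase S) :
    A.betaNbcBase 1 S ↔ Set.InjOn lv (S : Set (Fin n)) ∧
      ∀ i ∈ S, ∃ j, lv j = lv i ∧ j < i := by
  unfold betaNbcBase
  rw [h.nbcBase_iff hS]
  refine and_congr_right fun hinj => forall₂_congr fun i hi => ?_
  obtain ⟨hSl, hSc⟩ := (A.isBase_iff S).1 hS
  simp only [isBase_iff, Equiv.Perm.coe_one, id]
  constructor
  · rintro ⟨j, hj, hl, hc⟩
    refine ⟨j, le_antisymm (h.le_of_le hj.le) (not_lt.1 fun hlt => ?_), hj⟩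
    have hjS : j ∉ S := by
      intro hjS
      rw [Finset.insert_eq_of_mem (Finset.mem_erase.2 ⟨hj.ne, hjS⟩)] at hc
      have := Finset.card_erase_lt_of_mem hi
      omega
    have hF : ((S.filter fun s => lv s < lv i).image lv) = Finset.range (lv i) := by
      have := h.image_eq_range hS hinj
      ext p
      simp only [Finset.ext_iff, Finset.mem_image, Finset.mem_range, Finset.mem_filter]
        at this ⊢
      constructor
      · rintro ⟨s, ⟨-, hs⟩, rfl⟩
        exact hs
      · intro hp
        obtain ⟨s, hs, rfl⟩ := (this p).2 (hp.trans (h.lt_rank i))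
        exact ⟨s, ⟨hs, hp⟩, rfl⟩
    have hF' : lv i ≤ (S.filter fun s => lv s < lv i).card := by
      conv_lhs => rw [← Finset.card_range (lv i), ← hF]
      exact Finset.card_image_le
    have hsub : insert j (S.filter fun s => lv s < lv i) ⊆ insert j (S.erase i) := by
      refine Finset.insert_subset_insert _ fun s hs => ?_
      obtain ⟨hs, hlt⟩ := Finset.mem_filter.1 hs
      exact Finset.mem_erase.2 ⟨fun he => (he ▸ hlt).false, hs⟩
    have := h.card_le (hl.mono hsub) (h.lt_rank i).le (by simpa using hlt)
    rw [Finset.card_insert_of_notMem (by simp [hjS])] at this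
    omega
  · rintro ⟨j, hlv, hj⟩
    have hjS : j ∉ S := fun hjS => hj.ne (hinj hjS hi hlv)
    refine ⟨j, hj, h.linIndep_of_injOn ?_, ?_⟩
    · rw [Finset.coe_insert, Set.injOn_insert (by simp [hjS])]
      refine ⟨hinj.mono (by simp), ?_⟩
      rintro ⟨s, hs, he⟩
      obtain ⟨hsi, hs⟩ := Finset.mem_erase.1 (Finset.mem_coe.1 hs)
      exact hsi (hinj hs hi (he.trans hlv))
    · rw [Finset.card_insert_of_notMem (by simp [hjS]), Finset.card_erase_of_mem hi]
      have := Finset.card_pos.2 ⟨i, hi⟩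
      omega

end IsLevel

end FiniteDimensional

theorem tup_one_strictMono (S : Finset (Fin n)) : StrictMono (tup 1 S) := by
  intro p q hpq
  have := (Finset.orderIsoOfFin (S.image ⇑(1 : Equiv.Perm (Fin n)))
    (Finset.card_image_of_injective S (1 : Equiv.Perm (Fin n)).injective)).strictMono hpq
  exact this

theorem tup_one_mem (S : Finset (Fin n)) (p : Fin S.card) : tup 1 S p ∈ S := by
  have := ((S.image ⇑(1 : Equiv.Perm (Fin n))).orderIsoOfFin
    (Finset.card_image_of_injective S (1 : Equiv.Perm (Fin n)).injective) p).2
  obtain ⟨i, hi, h⟩ := Finset.mem_image.1 this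
  rwa [tup, ← h, Equiv.symm_apply_apply]

theorem exists_tup_one_eq {S : Finset (Fin n)} {i : Fin n} (hi : i ∈ S) :
    ∃ p, tup 1 S p = i := by
  obtain ⟨p, hp⟩ := ((S.image ⇑(1 : Equiv.Perm (Fin n))).orderIsoOfFin
    (Finset.card_image_of_injective S (1 : Equiv.Perm (Fin n)).injective)).surjective
      ⟨i, by simpa using hi⟩
  refine ⟨p, ?_⟩
  rw [tup, hp]
  rfl

theorem injOn_iff_level_tup {S : Finset (Fin n)} {lv : Fin n → ℕ} (hlv : ∀ i, lv i < S.card)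
    (hmono : Monotone lv) :
    Set.InjOn lv (S : Set (Fin n)) ↔ ∀ p : Fin S.card, lv (tup 1 S p) = p := by
  constructor
  · intro hinj
    set f : Fin S.card → Fin S.card := fun p => ⟨lv (tup 1 S p), hlv _⟩
    have hfm : StrictMono f := fun p q hpq => by
      refine lt_of_le_of_ne (hmono (tup_one_strictMono S hpq).le) fun he => ?_
      exact (tup_one_strictMono S hpq).ne
        (hinj (tup_one_mem S p) (tup_one_mem S q) (Fin.ext_iff.1 he))
    have hid : f = id := (hfm.range_inj strictMono_id).1 (by
      rw [(Finite.injective_iff_surjective.1 hfm.injective).range_eq, Set.range_id])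
    intro p
    exact Fin.ext_iff.1 (congrFun hid p)
  · intro h i hi j hj hij
    obtain ⟨p, rfl⟩ := exists_tup_one_eq hi
    obtain ⟨q, rfl⟩ := exists_tup_one_eq hj
    rw [h, h] at hij
    rw [Fin.ext hij]

end HArr

open scoped Classical
/-- For a supersolvable arrangement, ordered compatibly with the chain
`𝒜_1 ⊂ ⋯ ⊂ 𝒜_r`, a standard ordered base `B = (H_{i_1}, …, H_{i_r})` is an nbc-base iff
`H_{i_p} ∈ ℬ_p` for all `p`, and is a βnbc-base iff `H_{i_p} ∈ ℬ_p ∖ {min ℬ_p}` for all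
`p`, where `ℬ_p = 𝒜_p ∖ 𝒜_{p−1}`. -/
theorem supersolvable_nbc_betaNbc {W : Type} [AddCommGroup W] [Module ℂ W]
    [FiniteDimensional ℂ W] {n : ℕ} (A : HArr W n) (C : ℕ → Finset (Fin n))
    (h0 : C 0 = ∅) (htop : C A.rank = Finset.univ)
    (hchain : ∀ p, p < A.rank → C p ⊂ C (p + 1))
    (hrank : ∀ p, p ≤ A.rank → A.rankOn (C p) = p)
    (hmod : ∀ p, p ≤ A.rank → ∀ i ∈ C p, ∀ j ∈ C p, i ≠ j → A.H i ⊓ A.H j ≠ ⊥ →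
      ∃ q < p, ∃ k ∈ C q, A.H i ⊓ A.H j ≤ A.H k)
    (horder : ∀ p q : ℕ, 0 < p → p < q → q ≤ A.rank →
      ∀ i ∈ C p \ C (p - 1), ∀ j ∈ C q \ C (q - 1), i < j)
    (S : Finset (Fin n)) (hS : A.isBase S) :
    (A.nbcBase 1 S ↔ ∀ p : Fin S.card, HArr.tup 1 S p ∈ C ((p : ℕ) + 1) \ C (p : ℕ)) ∧
    (A.betaNbcBase 1 S ↔ ∀ p : Fin S.card,
      HArr.tup 1 S p ∈ C ((p : ℕ) + 1) \ C (p : ℕ) ∧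
      ¬ HArr.isMin 1 (HArr.tup 1 S p) (C ((p : ℕ) + 1) \ C (p : ℕ))) := by
  have hsub : ∀ q ≤ A.rank, ∀ p ≤ q, C p ⊆ C q := by
    intro q
    induction q with
    | zero => intro _ p hp; rw [Nat.le_zero.1 hp]
    | succ q ih =>
      intro hq p hp
      rcases hp.lt_or_eq with hlt | rfl
      · exact (ih (by omega) p (by omega)).trans (hchain q hq).subset
      · exact subset_rfl
  have hex : ∀ i, ∃ p, i ∈ C p := fun i => ⟨A.rank, htop ▸ Finset.mem_univ i⟩
  have hlevel : ∀ i, ∃ p < A.rank, i ∈ C (p + 1) ∧ i ∉ C p := by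
    intro i
    have hle : Nat.find (hex i) ≤ A.rank := Nat.find_min' _ (htop ▸ Finset.mem_univ i)
    have hmem := Nat.find_spec (hex i)
    have hpos : Nat.find (hex i) ≠ 0 := fun h => by simp [h, h0] at hmem
    obtain ⟨p, hp⟩ := Nat.exists_eq_succ_of_ne_zero hpos
    rw [hp] at hmem hle
    exact ⟨p, hle, hmem, Nat.find_min (hex i) (by omega)⟩
  choose lv hlt hmem hnot using hlevel
  have hC : ∀ p ≤ A.rank, ∀ i, i ∈ C p ↔ lv i < p := fun p hp i =>
    ⟨fun hi => not_le.1 fun hle => hnot i (hsub _ (hlt i).le _ hle hi),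
      fun hi => hsub p hp _ hi (hmem i)⟩
  have hL : A.IsLevel lv := by
    refine ⟨hlt, fun p hp => ?_, fun i j hij hlv hbot => ?_, fun i j hij => ?_⟩
    · conv_rhs => rw [← hrank p hp]
      congr 1
      ext i
      simp [hC p hp]
    · obtain ⟨q, hq, k, hk, hle⟩ :=
        hmod (lv j + 1) (hlt j) i (hlv ▸ hmem i) j (hmem j) hij hbot
      have := hlt j
      have := (hC q (by omega) k).1 hk
      exact ⟨k, by omega, hle⟩
    · exact horder (lv i + 1) (lv j + 1) (by omega) (by omega) (hlt j) i
        (by simp [hmem, hnot]) j (by simp [hmem, hnot])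
  have hcard : S.card = A.rank := ((A.isBase_iff S).1 hS).2
  have hblock : ∀ p : Fin S.card, ∀ i, i ∈ C ((p : ℕ) + 1) \ C (p : ℕ) ↔ lv i = p := by
    intro p i
    have := p.2
    rw [Finset.mem_sdiff, hC _ (by omega), hC _ (by omega)]
    omega
  have hinj := HArr.injOn_iff_level_tup (S := S) (fun i => hcard ▸ hlt i)
    (fun _ _ hij => hL.le_of_le hij)
  rw [hL.nbcBase_iff hS, hL.betaNbcBase_iff hS, hinj]
  simp only [HArr.isMin, hblock, forall_and, Equiv.Perm.coe_one, id]
  refine ⟨trivial, and_congr_right fun hlv => ?_⟩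
  constructor
  · rintro h p ⟨-, hmin⟩
    obtain ⟨j, hj, hji⟩ := h _ (HArr.tup_one_mem S p)
    exact hji.not_ge (hmin j (hj.trans (hlv p)))
  · intro h i hi
    obtain ⟨p, rfl⟩ := HArr.exists_tup_one_eq hi
    have hp := h p
    push Not at hp
    obtain ⟨j, hj, hji⟩ := hp (hlv p)
    exact ⟨j, hj.trans (hlv p).symm, hji⟩
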